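/- Let n ≥ 1 be an integer and let ξ ∈ F_q((T^{-1})) be not algebraic of degree at most n over F_q(T). Then w_n(ξ) ≥ n and w_n*(ξ) ≥ (n+1)/2. -/

import Mathlib

open Polynomial Filter Set
open scoped Classical

noncomputable section

namespace OotoT

variable (Fq : Type) [Field Fq]

/-- We model the field `F_q((T⁻¹))` of Laurent series in `T⁻¹` as `LaurentSeries Fq`,
whose canonical variable `u` plays the role of `T⁻¹`.  Thus `T` itself is `u⁻¹`. -/
def Tel : LaurentSeries Fq := (HahnSeries.single (1 : ℤ) (1 : Fq))⁻¹

/-- The canonical ring embedding `F_q[T] → F_q((T⁻¹))`, sending `T ↦ u⁻¹`. -/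
def ringHomT : Polynomial Fq →+* LaurentSeries Fq :=
  Polynomial.eval₂RingHom (HahnSeries.C : Fq →+* LaurentSeries Fq) (Tel Fq)

/-- The absolute value on `F_q((T⁻¹))`: `|0| = 0` and `|ξ| = q^{-N}` where
`ξ = Σ_{n ≥ N} a_n T^{-n}` with `a_N ≠ 0`; in our model `N` is the order of `ξ`
as a Hahn series in `u = T⁻¹`. -/
def absL (q : ℕ) (ξ : LaurentSeries Fq) : ℝ :=
  if ξ = 0 then 0 else (q : ℝ) ^ (-ξ.order)

/-- Evaluation of a polynomial `P(X) ∈ (F_q[T])[X]` at `ξ ∈ F_q((T⁻¹))`. -/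
def evalP (ξ : LaurentSeries Fq) (P : Polynomial (Polynomial Fq)) : LaurentSeries Fq :=
  Polynomial.eval₂ (ringHomT Fq) ξ P

/-- The height of `P(X) ∈ (F_q[T])[X]`: the maximum of the absolute values of its
coefficients.  A nonzero `c ∈ F_q[T]` has `|c| = q^{deg c}`, so for `P ≠ 0` the height
is `q` raised to the maximal degree of a (nonzero) coefficient of `P`. -/
def heightP (q : ℕ) (P : Polynomial (Polynomial Fq)) : ℝ :=
  if P = 0 then 0 else (q : ℝ) ^ (P.support.sup fun i => (P.coeff i).natDegree)

/-- `w_n(ξ)`: the supremum (in the extended reals) of the real numbers `w` such that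
`0 < |P(ξ)| ≤ H(P)^{-w}` for infinitely many `P(X) ∈ (F_q[T])[X]` of degree at most `n`. -/
def wn (q : ℕ) (n : ℕ) (ξ : LaurentSeries Fq) : EReal :=
  sSup ((fun w : ℝ => (w : EReal)) ''
    {w : ℝ | {P : Polynomial (Polynomial Fq) | P.natDegree ≤ n ∧
      0 < absL Fq q (evalP Fq ξ P) ∧
      absL Fq q (evalP Fq ξ P) ≤ heightP Fq q P ^ (-w)}.Infinite})

/-- `w(ξ) = limsup_{n→∞} w_n(ξ)/n`. -/
def wB (q : ℕ) (ξ : LaurentSeries Fq) : EReal :=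
  Filter.limsup (fun n : ℕ => wn Fq q n ξ / (n : EReal)) Filter.atTop

/-- `ξ` is an `A`-number if `w(ξ) = 0`. -/
def IsANumber (q : ℕ) (ξ : LaurentSeries Fq) : Prop := wB Fq q ξ = 0

/-- `ξ` is an `S`-number if `0 < w(ξ) < +∞`. -/
def IsSNumber (q : ℕ) (ξ : LaurentSeries Fq) : Prop := 0 < wB Fq q ξ ∧ wB Fq q ξ < ⊤

/-- `ξ` is a `T`-number if `w(ξ) = +∞` and `w_n(ξ) < +∞` for all `n ≥ 1`. -/
def IsTNumber (q : ℕ) (ξ : LaurentSeries Fq) : Prop :=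
  wB Fq q ξ = ⊤ ∧ ∀ n : ℕ, 1 ≤ n → wn Fq q n ξ < ⊤

/-- `ξ` is a `U`-number if `w(ξ) = +∞` and `w_n(ξ) = +∞` for some `n ≥ 1`. -/
def IsUNumber (q : ℕ) (ξ : LaurentSeries Fq) : Prop :=
  wB Fq q ξ = ⊤ ∧ ∃ n : ℕ, 1 ≤ n ∧ wn Fq q n ξ = ⊤

/-- The type `t(ξ) = limsup_{n→∞} (log w_n(ξ))/(log n)` of a `T`-number (as an
extended real; for a `T`-number each `w_n(ξ)` is a finite real, recovered by `toReal`). -/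
def typeT (q : ℕ) (ξ : LaurentSeries Fq) : EReal :=
  Filter.limsup
    (fun n : ℕ => ((Real.log (wn Fq q n ξ).toReal / Real.log n : ℝ) : EReal)) Filter.atTop

/-! ### The algebraic closure side -/

/-- The algebraic closure of `F_q((T⁻¹))`. -/
abbrev AC := AlgebraicClosure (LaurentSeries Fq)

/-- The canonical embedding of `F_q((T⁻¹))` into its algebraic closure. -/
def iota : LaurentSeries Fq →+* AC Fq := algebraMap _ _

/-- The embedding `F_q[T] → AC`. -/
def ringHomTC : Polynomial Fq →+* AC Fq := (iota Fq).comp (ringHomT Fq)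

/-- Evaluation of `P(X) ∈ (F_q[T])[X]` at an element of the algebraic closure. -/
def evalPC (α : AC Fq) (P : Polynomial (Polynomial Fq)) : AC Fq :=
  Polynomial.eval₂ (ringHomTC Fq) α P

/-- `P ∈ (F_q[T])[X]` is *the* minimal polynomial of `α`: it is non-constant, irreducible,
primitive, its leading coefficient is monic (in `T`), and `P(α) = 0`.  For `α` algebraic
over `F_q(T)` such a polynomial exists and is unique. -/
def IsMinPolyOf (α : AC Fq) (P : Polynomial (Polynomial Fq)) : Prop :=
  0 < P.natDegree ∧ Irreducible P ∧ P.IsPrimitive ∧ P.leadingCoeff.Monic ∧ evalPC Fq α P = 0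

/-- `α` is algebraic over `F_q(T)`. -/
def IsAlgT (α : AC Fq) : Prop := ∃ P, IsMinPolyOf Fq α P

/-- The degree of an algebraic `α`: the degree of its minimal polynomial. -/
def degT (α : AC Fq) : ℕ := if h : IsAlgT Fq α then h.choose.natDegree else 0

/-- The height of an algebraic `α`: the height of its minimal polynomial. -/
def heightT (q : ℕ) (α : AC Fq) : ℝ := if h : IsAlgT Fq α then heightP Fq q h.choose else 0

/-- The unique extension of the absolute value to the algebraic closure of `F_q((T⁻¹))`,
given by the standard formula `|x| = |N_{K(x)/K}(x)|^{1/[K(x):K]}`, i.e.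
`|x| = |c₀|^{1/d}` where `c₀` is the constant coefficient and `d` the degree of the
minimal polynomial of `x` over `K = F_q((T⁻¹))`. -/
def absC (q : ℕ) (x : AC Fq) : ℝ :=
  absL Fq q ((minpoly (LaurentSeries Fq) x).coeff 0) ^
    (((minpoly (LaurentSeries Fq) x).natDegree : ℝ)⁻¹)

/-- `w_n^*(ξ)`: the supremum (in the extended reals) of the real numbers `w` such that
`0 < |ξ - α| ≤ H(α)^{-w-1}` for infinitely many `α` algebraic over `F_q(T)` of degree
at most `n`. -/
def wnStar (q : ℕ) (n : ℕ) (ξ : LaurentSeries Fq) : EReal :=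
  sSup ((fun w : ℝ => (w : EReal)) ''
    {w : ℝ | {α : AC Fq | IsAlgT Fq α ∧ degT Fq α ≤ n ∧
      0 < absC Fq q (iota Fq ξ - α) ∧
      absC Fq q (iota Fq ξ - α) ≤ heightT Fq q α ^ (-w - 1)}.Infinite})

/-- `w^*(ξ) = limsup_{n→∞} w_n^*(ξ)/n`. -/
def wBStar (q : ℕ) (ξ : LaurentSeries Fq) : EReal :=
  Filter.limsup (fun n : ℕ => wnStar Fq q n ξ / (n : EReal)) Filter.atTop

/-- `ξ` is an `A*`-number if `w^*(ξ) = 0`. -/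
def IsAStarNumber (q : ℕ) (ξ : LaurentSeries Fq) : Prop := wBStar Fq q ξ = 0

/-- `ξ` is a `T*`-number if `w^*(ξ) = +∞` and `w_n^*(ξ) < +∞` for all `n ≥ 1`. -/
def IsTStarNumber (q : ℕ) (ξ : LaurentSeries Fq) : Prop :=
  wBStar Fq q ξ = ⊤ ∧ ∀ n : ℕ, 1 ≤ n → wnStar Fq q n ξ < ⊤

/-- The `*`-type `t^*(ξ) = limsup_{n→∞} (log w_n^*(ξ))/(log n)` of a `T*`-number. -/
def typeTStar (q : ℕ) (ξ : LaurentSeries Fq) : EReal :=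
  Filter.limsup
    (fun n : ℕ => ((Real.log (wnStar Fq q n ξ).toReal / Real.log n : ℝ) : EReal)) Filter.atTop

/-! ### The Laurent series `ξ(r, m)` -/

/-- `r_j = r^{m_0 m_1 ⋯ m_j}`. -/
def rr (r : ℕ) (m : ℕ → ℕ) (j : ℕ) : ℕ := r ^ (∏ i ∈ Finset.range (j + 1), m i)

/-- `α_j(r, m) = Σ_{n=1}^∞ T^{-r_j^n}`, i.e. the power series in `u = T⁻¹` whose
`k`-th coefficient is `1` exactly when `k = r_j^n` for some `n ≥ 1`. -/
def alphaJ (r : ℕ) (m : ℕ → ℕ) (j : ℕ) : LaurentSeries Fq :=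
  HahnSeries.ofPowerSeries ℤ Fq (PowerSeries.mk fun k =>
    if ∃ n : ℕ, 1 ≤ n ∧ k = rr r m j ^ n then 1 else 0)

/-- `ξ_a(r, m) = Σ_{j=0}^∞ a_j α_j(r, m)`, described coefficientwise: the coefficient of
`T^{-k}` is the (finite) sum over `j` of `a_j` times the coefficient of `T^{-k}` in
`α_j(r, m)`. -/
def xiA (r : ℕ) (m : ℕ → ℕ) (a : ℕ → ℕ) : LaurentSeries Fq :=
  HahnSeries.ofPowerSeries ℤ Fq (PowerSeries.mk fun k =>
    ∑ᶠ j : ℕ, (a j : Fq) * (if ∃ n : ℕ, 1 ≤ n ∧ k = rr r m j ^ n then 1 else 0))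

/-- `ξ(r, m) = Σ_{j=0}^∞ α_j(r, m)`. -/
def xi (r : ℕ) (m : ℕ → ℕ) : LaurentSeries Fq := xiA Fq r m fun _ => 1

/-! ### Algebraicity and algebraic dependence over `F_q(T)` for Laurent series -/

/-- `ξ ∈ F_q((T⁻¹))` is algebraic over `F_q(T)`. -/
def IsAlgLS (ξ : LaurentSeries Fq) : Prop :=
  ∃ P : Polynomial (Polynomial Fq), P ≠ 0 ∧ evalP Fq ξ P = 0

/-- Evaluation of a two-variable polynomial `F(X, Y) ∈ (F_q[T])[X, Y]` (coded as an
iterated polynomial ring, `T` innermost, then `X`, then `Y`) at `(ξ, η)`. -/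
def evalXY (ξ η : LaurentSeries Fq) (F : Polynomial (Polynomial (Polynomial Fq))) :
    LaurentSeries Fq :=
  Polynomial.eval₂ (Polynomial.eval₂RingHom (ringHomT Fq) ξ) η F

/-- `ξ` and `η` are algebraically dependent over `F_q(T)`. -/
def AlgDep (ξ η : LaurentSeries Fq) : Prop :=
  ∃ F : Polynomial (Polynomial (Polynomial Fq)), F ≠ 0 ∧ evalXY Fq ξ η F = 0

/-- `deg_X` of `F(X, Y) ∈ (F_q[T])[X, Y]` in our encoding. -/
def degX (F : Polynomial (Polynomial (Polynomial Fq))) : ℕ :=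
  F.support.sup fun i => (F.coeff i).natDegree

/-- `F(X, Y) ∈ (F_q[T])[X, Y]` is primitive (in `X` and `Y`): no non-unit of `F_q[T]`
divides all of its coefficients. -/
def IsPrimitiveXY (F : Polynomial (Polynomial (Polynomial Fq))) : Prop :=
  ∀ c : Polynomial Fq, (∀ i j : ℕ, c ∣ ((F.coeff i).coeff j)) → IsUnit c

end OotoT

open OotoT

namespace OotoT

section

variable {Fq : Type} [Field Fq]

lemma absL_zero (q : ℕ) : absL Fq q 0 = 0 := by simp [absL]

lemma absL_nonneg (q : ℕ) (x : LaurentSeries Fq) : 0 ≤ absL Fq q x := by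
  unfold absL; split_ifs <;> positivity

lemma absL_pos {q : ℕ} (hq : 1 < q) {x : LaurentSeries Fq} (hx : x ≠ 0) : 0 < absL Fq q x := by
  have : (0 : ℝ) < q := by positivity
  rw [absL, if_neg hx]; positivity

lemma absL_eq_zero {q : ℕ} (hq : 1 < q) {x : LaurentSeries Fq} : absL Fq q x = 0 ↔ x = 0 :=
  ⟨fun h => by_contra fun hx => (absL_pos hq hx).ne' h, fun h => h ▸ absL_zero q⟩

lemma absL_mul {q : ℕ} (hq : 1 < q) (x y : LaurentSeries Fq) :
    absL Fq q (x * y) = absL Fq q x * absL Fq q y := by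
  have h0 : (q : ℝ) ≠ 0 := by positivity
  by_cases hx : x = 0
  · simp [hx, absL_zero]
  by_cases hy : y = 0
  · simp [hy, absL_zero]
  rw [absL, absL, absL, if_neg hx, if_neg hy, if_neg (mul_ne_zero hx hy),
    HahnSeries.order_mul hx hy, neg_add, zpow_add₀ h0]

/-- The absolute value of a Laurent series is governed by its first nonzero coefficient. -/
lemma absL_le_zpow_iff {q : ℕ} (hq : 1 < q) {x : LaurentSeries Fq} {D : ℤ} :
    absL Fq q x ≤ (q : ℝ) ^ (-D) ↔ ∀ i < D, x.coeff i = 0 := by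
  have h1 : (1 : ℝ) < q := by exact_mod_cast hq
  by_cases hx : x = 0
  · simp only [hx, absL_zero, HahnSeries.coeff_zero, implies_true, iff_true]
    positivity
  rw [absL, if_neg hx, zpow_le_zpow_iff_right₀ h1, neg_le_neg_iff,
    HahnSeries.le_order_iff_forall hx]

lemma absL_add_le_max {q : ℕ} (hq : 1 < q) (x y : LaurentSeries Fq) :
    absL Fq q (x + y) ≤ max (absL Fq q x) (absL Fq q y) := by
  by_cases hx : x = 0
  · simp [hx]
  by_cases hy : y = 0
  · simp [hy]
  have key : ∀ u v : LaurentSeries Fq, u ≠ 0 → absL Fq q v ≤ absL Fq q u →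
      absL Fq q (u + v) ≤ absL Fq q u := by
    intro u v hu h
    rw [show absL Fq q u = (q : ℝ) ^ (-u.order) by rw [absL, if_neg hu]] at h ⊢
    rw [absL_le_zpow_iff hq] at h ⊢
    intro i hi
    rw [HahnSeries.coeff_add, h i hi, HahnSeries.coeff_eq_zero_of_lt_order hi, add_zero]
  rcases le_total (absL Fq q x) (absL Fq q y) with h | h
  · rw [max_eq_right h, add_comm]; exact key y x hy h
  · rw [max_eq_left h]; exact key x y hx h

/-- `absL` as an absolute value. -/
def absLAV (Fq : Type) [Field Fq] {q : ℕ} (hq : 1 < q) : AbsoluteValue (LaurentSeries Fq) ℝ where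
  toFun := absL Fq q
  map_mul' := absL_mul hq
  nonneg' := absL_nonneg q
  eq_zero' _ := absL_eq_zero hq
  add_le' x y := (absL_add_le_max hq x y).trans
    (max_le_add_of_nonneg (absL_nonneg q x) (absL_nonneg q y))

/-- The normed field structure on `F_q((T⁻¹))` given by `absL`. -/
abbrev normedFieldL (Fq : Type) [Field Fq] {q : ℕ} (hq : 1 < q) :
    NormedField (LaurentSeries Fq) :=
  (absLAV Fq hq).toNormedField

lemma completeSpaceL {q : ℕ} (hq : 1 < q) :
    @CompleteSpace (LaurentSeries Fq) (normedFieldL Fq hq).toUniformSpace := by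
  let := normedFieldL Fq hq
  have h1 : (1 : ℝ) < q := by exact_mod_cast hq
  have h0 : (0 : ℝ) < q := by positivity
  apply Metric.complete_of_cauchySeq_tendsto
  intro u hu
  rw [Metric.cauchySeq_iff'] at hu
  have hcoef : ∀ D : ℤ, ∃ N : ℕ, ∀ n ≥ N, ∀ i < D, (u n).coeff i = (u N).coeff i := by
    intro D
    obtain ⟨N, hN⟩ := hu ((q : ℝ) ^ (-D)) (by positivity)
    refine ⟨N, fun n hn i hi => ?_⟩
    have h := (hN n hn).le
    rw [dist_eq_norm] at h
    have h2 := (absL_le_zpow_iff hq).1 (show absL Fq q (u n - u N) ≤ _ from h) i hi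
    rwa [HahnSeries.coeff_sub, sub_eq_zero] at h2
  choose N hN using hcoef
  set c : ℤ → Fq := fun d => (u (N (d + 1))).coeff d with hc
  have hcN : ∀ D : ℤ, ∀ n ≥ N D, ∀ i < D, (u n).coeff i = c i := by
    intro D n hn i hi
    have e1 := hN (i + 1) (max (N (i + 1)) n) (le_max_left _ _) i (by omega)
    have e2 := hN D (max (N (i + 1)) n) (hn.trans (le_max_right _ _)) i hi
    have e3 := hN D n hn i hi
    rw [e3, ← e2, e1]
  let x : LaurentSeries Fq := HahnSeries.ofSuppBddBelow c ⟨min 0 (u (N 0)).order, by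
    intro i hi
    by_contra! hlt
    apply hi
    show c i = 0
    rw [← hcN 0 (N 0) le_rfl i (by omega)]
    exact HahnSeries.coeff_eq_zero_of_lt_order (by omega)⟩
  refine ⟨x, Metric.tendsto_atTop.2 fun ε hε => ?_⟩
  obtain ⟨k, hk⟩ := exists_pow_lt_of_lt_one hε (inv_lt_one_of_one_lt₀ h1)
  refine ⟨N k, fun n hn => ?_⟩
  rw [dist_eq_norm]
  refine lt_of_le_of_lt (b := (q : ℝ) ^ (-(k : ℤ))) ?_ (by simpa using hk)
  refine (absL_le_zpow_iff hq).2 fun i hi => ?_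
  rw [HahnSeries.coeff_sub, hcN k n hn i hi]
  exact sub_self _

/-- `absC` is a nonarchimedean absolute value extending `absL`. -/
lemma exists_absC_eq {q : ℕ} (hq : 1 < q) : ∃ v : AbsoluteValue (AC Fq) ℝ,
    IsNonarchimedean v ∧ (∀ x, v x = absC Fq q x) ∧ ∀ x, v (iota Fq x) = absL Fq q x := by
  have h1 : (1 : ℝ) < q := by exact_mod_cast hq
  let : NormedField (LaurentSeries Fq) := normedFieldL Fq hq
  let : NontriviallyNormedField (LaurentSeries Fq) :=
    { normedFieldL Fq hq with
      non_trivial := by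
        refine ⟨HahnSeries.single (-1 : ℤ) (1 : Fq), ?_⟩
        show 1 < absL Fq q _
        rw [absL, if_neg (by simp), HahnSeries.order_single one_ne_zero]
        simpa using h1 }
  have : @CompleteSpace (LaurentSeries Fq) (normedFieldL Fq hq).toUniformSpace := completeSpaceL hq
  have : @IsUltrametricDist (LaurentSeries Fq) (normedFieldL Fq hq).toDist :=
    IsUltrametricDist.isUltrametricDist_of_isNonarchimedean_norm (absL_add_le_max hq)
  let s := spectralMulAlgNorm (LaurentSeries Fq) (AC Fq)
  refine ⟨{ toFun := s, map_mul' := map_mul s, nonneg' := apply_nonneg s,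
            eq_zero' := fun x => map_eq_zero_iff_eq_zero s,
            add_le' := map_add_le_add s }, ?_, ?_, ?_⟩
  · exact isNonarchimedean_spectralNorm
  · intro x
    show spectralNorm _ _ x = _
    rw [spectralNorm.spectralNorm_eq_norm_coeff_zero_rpow, one_div]
    rfl
  · intro x
    exact spectralNorm_extends x

lemma isNonarchimedean_absLAV {q : ℕ} (hq : 1 < q) : IsNonarchimedean (absLAV Fq hq) :=
  absL_add_le_max hq

lemma absL_ringHomT {q : ℕ} (hq : 1 < q) {c : Polynomial Fq} (hc : c ≠ 0) :
    absL Fq q (ringHomT Fq c) = (q : ℝ) ^ c.natDegree := by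
  have h1 : (1 : ℝ) < q := by exact_mod_cast hq
  have hv : ∀ x, absLAV Fq hq x = absL Fq q x := fun _ => rfl
  have hC : ∀ a : Fq, a ≠ 0 → absL Fq q (HahnSeries.C a) = 1 := by
    intro a ha
    simp [absL, ha]
  have hT : absL Fq q (Tel Fq) = q := by
    have h : absL Fq q (HahnSeries.single (1 : ℤ) (1 : Fq)) = (q : ℝ)⁻¹ := by
      rw [absL, if_neg (by simp), HahnSeries.order_single one_ne_zero]
      simp
    rw [← hv, Tel, map_inv₀, hv, h, inv_inv]
  have hterm : ∀ i, c.coeff i ≠ 0 →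
      absLAV Fq hq (HahnSeries.C (c.coeff i) * Tel Fq ^ i) = (q : ℝ) ^ i := by
    intro i hi
    rw [map_mul, map_pow, hv, hv, hC _ hi, hT, one_mul]
  have hsum : ringHomT Fq c = ∑ i ∈ c.support, HahnSeries.C (c.coeff i) * Tel Fq ^ i := by
    rw [ringHomT, coe_eval₂RingHom, eval₂_eq_sum, Polynomial.sum_def]
  have hmem : c.natDegree ∈ c.support := natDegree_mem_support_of_nonzero hc
  rw [← hv, hsum, (isNonarchimedean_absLAV hq).apply_sum_eq_of_lt (k := c.natDegree)
    (fun a => ((absLAV Fq hq).map_neg a).symm) hmem, hterm _ (mem_support_iff.1 hmem)]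
  intro j hj hne
  rw [hterm _ (mem_support_iff.1 hj), hterm _ (mem_support_iff.1 hmem)]
  exact pow_lt_pow_right₀ h1 (lt_of_le_of_ne (le_natDegree_of_mem_supp j hj) hne)

lemma ringHomT_injective {q : ℕ} (hq : 1 < q) : Function.Injective (ringHomT Fq) := by
  rw [injective_iff_map_eq_zero]
  intro c h
  by_contra hc
  have := absL_ringHomT hq hc
  rw [h, absL_zero] at this
  have h0 : (q : ℝ) ≠ 0 := by positivity
  exact pow_ne_zero _ h0 this.symm

lemma ringHomTC_injective {q : ℕ} (hq : 1 < q) : Function.Injective (ringHomTC Fq) :=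
  (RingHom.injective (iota Fq)).comp (ringHomT_injective hq)

lemma evalPC_iota (ξ : LaurentSeries Fq) (P : Polynomial (Polynomial Fq)) :
    evalPC Fq (iota Fq ξ) P = iota Fq (evalP Fq ξ P) := by
  rw [evalPC, evalP, hom_eval₂, ringHomTC]

lemma one_le_heightP {q : ℕ} (hq : 1 < q) {P : Polynomial (Polynomial Fq)} (hP : P ≠ 0) :
    1 ≤ heightP Fq q P := by
  rw [heightP, if_neg hP]
  exact one_le_pow₀ (by exact_mod_cast hq.le)

lemma heightP_eq_gaussNorm {q : ℕ} (hq : 1 < q) {v : AbsoluteValue (AC Fq) ℝ}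
    (hext : ∀ x, v (iota Fq x) = absL Fq q x)
    (P : Polynomial (Polynomial Fq)) :
    heightP Fq q P = (P.map (ringHomTC Fq)).gaussNorm v 1 := by
  have h1 : (1 : ℝ) < q := by exact_mod_cast hq
  by_cases hP : P = 0
  · simp [hP, heightP]
  have hcoeff : ∀ i, P.coeff i ≠ 0 →
      v ((P.map (ringHomTC Fq)).coeff i) = (q : ℝ) ^ (P.coeff i).natDegree := by
    intro i hi
    rw [coeff_map, ringHomTC, RingHom.comp_apply, hext, absL_ringHomT hq hi]
  rw [heightP, if_neg hP]
  apply le_antisymm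
  · obtain ⟨i, hi, h⟩ := Finset.exists_mem_eq_sup P.support
      (support_nonempty.2 hP) (fun i => (P.coeff i).natDegree)
    rw [h, ← hcoeff i (mem_support_iff.1 hi)]
    simpa using (P.map (ringHomTC Fq)).le_gaussNorm v zero_le_one i
  · obtain ⟨i, hi⟩ := (P.map (ringHomTC Fq)).exists_eq_gaussNorm v 1
    rw [hi, one_pow, mul_one]
    by_cases h : P.coeff i = 0
    · rw [coeff_map, h, map_zero, map_zero]; positivity
    · rw [hcoeff i h]
      exact pow_le_pow_right₀ h1.le
        (Finset.le_sup (f := fun i => (P.coeff i).natDegree) (mem_support_iff.2 h))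

lemma heightP_mul {q : ℕ} (hq : 1 < q) {v : AbsoluteValue (AC Fq) ℝ}
    (hna : IsNonarchimedean v) (hext : ∀ x, v (iota Fq x) = absL Fq q x)
    (P Q : Polynomial (Polynomial Fq)) :
    heightP Fq q (P * Q) = heightP Fq q P * heightP Fq q Q := by
  simp only [heightP_eq_gaussNorm hq hext, Polynomial.map_mul, gaussNorm_mul hna one_pos]

lemma heightP_le_of_dvd {q : ℕ} (hq : 1 < q) {v : AbsoluteValue (AC Fq) ℝ}
    (hna : IsNonarchimedean v) (hext : ∀ x, v (iota Fq x) = absL Fq q x)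
    {P Q : Polynomial (Polynomial Fq)} (hQ : Q ≠ 0) (h : P ∣ Q) :
    heightP Fq q P ≤ heightP Fq q Q := by
  obtain ⟨R, rfl⟩ := h
  rw [heightP_mul hq hna hext]
  exact le_mul_of_one_le_right (zero_le_one.trans (one_le_heightP hq (left_ne_zero_of_mul hQ)))
    (one_le_heightP hq (right_ne_zero_of_mul hQ))

lemma gaussNorm_X_sub_C {K : Type*} [Field K] (v : AbsoluteValue K ℝ) (a : K) :
    (X - C a).gaussNorm v 1 = max 1 (v a) := by
  apply le_antisymm
  · obtain ⟨i, hi⟩ := (X - C a).exists_eq_gaussNorm v 1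
    rw [hi, one_pow, mul_one]
    rcases i with _ | _ | i
    · simp
    · simp [coeff_X]
    · simp [coeff_X]
  · have h0 := (X - C a).le_gaussNorm v zero_le_one 0
    have h1 := (X - C a).le_gaussNorm v zero_le_one 1
    simp [coeff_C] at h0 h1
    exact max_le h1 h0

/-- A polynomial splits over the algebraic closure into linear factors. -/
lemma exists_roots {q : ℕ} (hq : 1 < q) (P : Polynomial (Polynomial Fq)) :
    ∃ r : Fin P.natDegree → AC Fq,
      P.map (ringHomTC Fq) = C (ringHomTC Fq P.leadingCoeff) * ∏ i, (X - C (r i)) := by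
  have hs : (P.map (ringHomTC Fq)).Splits := IsAlgClosed.splits _
  have hinj := ringHomTC_injective (Fq := Fq) hq
  have hlen : (P.map (ringHomTC Fq)).roots.toList.length = P.natDegree := by
    rw [Multiset.length_toList, ← hs.natDegree_eq_card_roots, natDegree_map_eq_of_injective hinj]
  refine ⟨fun i => (P.map (ringHomTC Fq)).roots.toList.get (i.cast hlen.symm), ?_⟩
  conv_lhs => rw [hs.eq_prod_roots, leadingCoeff_map_of_injective hinj,
    ← Multiset.coe_toList (P.map (ringHomTC Fq)).roots]
  congr 1
  rw [Multiset.map_coe, Multiset.prod_coe, ← Fin.prod_univ_fun_getElem]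
  exact (Fintype.prod_equiv (finCongr hlen) _ _ (fun i => rfl))

lemma heightP_eq_prod {q : ℕ} (hq : 1 < q) {v : AbsoluteValue (AC Fq) ℝ}
    (hna : IsNonarchimedean v) (hext : ∀ x, v (iota Fq x) = absL Fq q x)
    {P : Polynomial (Polynomial Fq)} {r : Fin P.natDegree → AC Fq}
    (hr : P.map (ringHomTC Fq) = C (ringHomTC Fq P.leadingCoeff) * ∏ i, (X - C (r i))) :
    heightP Fq q P = v (ringHomTC Fq P.leadingCoeff) * ∏ i, max 1 (v (r i)) := by
  have hprod : ∀ s : Finset (Fin P.natDegree),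
      (∏ i ∈ s, (X - C (r i))).gaussNorm v 1 = ∏ i ∈ s, max 1 (v (r i)) := by
    intro s
    induction s using Finset.induction_on with
    | empty => simp [← C_1, -map_one, gaussNorm_C v 1 (1 : AC Fq)]
    | insert a s ha ih =>
      rw [Finset.prod_insert ha, Finset.prod_insert ha, gaussNorm_mul hna one_pos, ih,
        gaussNorm_X_sub_C]
  rw [heightP_eq_gaussNorm hq hext, hr, gaussNorm_mul hna one_pos, hprod,
    gaussNorm_C v 1]

lemma absL_evalP_eq_prod {q : ℕ} {v : AbsoluteValue (AC Fq) ℝ}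
    (hext : ∀ x, v (iota Fq x) = absL Fq q x)
    {P : Polynomial (Polynomial Fq)} {r : Fin P.natDegree → AC Fq}
    (hr : P.map (ringHomTC Fq) = C (ringHomTC Fq P.leadingCoeff) * ∏ i, (X - C (r i)))
    (ξ : LaurentSeries Fq) :
    absL Fq q (evalP Fq ξ P) =
      v (ringHomTC Fq P.leadingCoeff) * ∏ i, v (iota Fq ξ - r i) := by
  rw [← hext, ← evalPC_iota, evalPC, ← eval_map, hr]
  simp [eval_prod]

/-- A nonzero resultant of two polynomials over `F_q[T]` has absolute value at least one. -/
lemma one_le_resultant_prod {q : ℕ} (hq : 1 < q) {v : AbsoluteValue (AC Fq) ℝ}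
    (hext : ∀ x, v (iota Fq x) = absL Fq q x)
    {P Q : Polynomial (Polynomial Fq)} (h0 : P ≠ 0) (hPQ : resultant P Q ≠ 0)
    {r : Fin P.natDegree → AC Fq} {s : Fin Q.natDegree → AC Fq}
    (hr : P.map (ringHomTC Fq) = C (ringHomTC Fq P.leadingCoeff) * ∏ i, (X - C (r i)))
    (hs : Q.map (ringHomTC Fq) = C (ringHomTC Fq Q.leadingCoeff) * ∏ i, (X - C (s i))) :
    1 ≤ v (ringHomTC Fq P.leadingCoeff) ^ Q.natDegree *
      v (ringHomTC Fq Q.leadingCoeff) ^ P.natDegree * ∏ i, ∏ j, v (r i - s j) := by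
  have hinj := ringHomTC_injective (Fq := Fq) hq
  have h1 : 1 ≤ v (ringHomTC Fq (resultant P Q)) := by
    rw [ringHomTC, RingHom.comp_apply, hext, absL_ringHomT hq hPQ]
    exact one_le_pow₀ (by exact_mod_cast hq.le)
  refine h1.trans_eq ?_
  have hroots : (P.map (ringHomTC Fq)).roots = Finset.univ.val.map r := by
    rw [hr, roots_C_mul _ (by simpa [map_eq_zero_iff _ hinj] using h0),
      Finset.prod_eq_multiset_prod, ← roots_multiset_prod_X_sub_C (Finset.univ.val.map r),
      Multiset.map_map]
    rfl
  have hev := resultant_eq_prod_eval (P.map (ringHomTC Fq)) (Q.map (ringHomTC Fq)) Q.natDegree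
    natDegree_map_le (IsAlgClosed.splits _)
  rw [natDegree_map_eq_of_injective hinj, resultant_map_map] at hev
  rw [hev, hroots, Multiset.map_map, leadingCoeff_map_of_injective hinj, map_mul, map_pow,
    mul_assoc]
  congr 1
  change v (∏ i, (Q.map (ringHomTC Fq)).eval (r i)) = _
  have : ∀ i, (Q.map (ringHomTC Fq)).eval (r i) =
      ringHomTC Fq Q.leadingCoeff * ∏ j, (r i - s j) := by
    intro i
    rw [hs]; simp [eval_prod]
  simp only [this, map_prod, map_mul, map_pow, Finset.prod_mul_distrib,
    Finset.prod_const, Finset.card_univ,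
    Fintype.card_fin]

/-- A primitive irreducible polynomial divides every polynomial sharing a root with it. -/
lemma dvd_of_eval₂_eq_zero {R L : Type*} (K : Type*) [CommRing R] [IsDomain R]
    [NormalizedGCDMonoid R] [Field K] [Algebra R K] [IsFractionRing R K] [Field L] {f : R →+* L}
    (hf : Function.Injective f) {α : L} {F P : R[X]} (hirr : Irreducible F)
    (hprim : F.IsPrimitive) (hF : F.eval₂ f α = 0) (hP : P.eval₂ f α = 0) : F ∣ P := by
  have heval : ∀ R : R[X], (R.map (algebraMap _ K)).eval₂ (IsFractionRing.lift hf) α =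
      R.eval₂ f α := by
    intro R
    rw [eval₂_map]
    congr 1
    exact RingHom.ext fun x => IsFractionRing.lift_algebraMap hf x
  rw [hprim.dvd_iff_fraction_map_dvd_fraction_map K]
  by_contra hndvd
  have hirr' := (hprim.irreducible_iff_irreducible_map_fraction_map (K := K)).1 hirr
  obtain ⟨a, b, hab⟩ := (hirr'.coprime_iff_not_dvd).2 hndvd
  have := congrArg (eval₂ (IsFractionRing.lift hf) α) hab
  rw [eval₂_add, eval₂_mul, eval₂_mul, heval, heval, hF, hP, mul_zero, mul_zero, add_zero,
    eval₂_one] at this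
  exact zero_ne_one this

lemma IsMinPolyOf.dvd {q : ℕ} (hq : 1 < q) {α : AC Fq} {F P : Polynomial (Polynomial Fq)}
    (hF : IsMinPolyOf Fq α F) (hP : evalPC Fq α P = 0) : F ∣ P :=
  dvd_of_eval₂_eq_zero (FractionRing (Polynomial Fq)) (ringHomTC_injective (Fq := Fq) hq)
    hF.2.1 hF.2.2.1 hF.2.2.2.2 hP

lemma exists_isMinPolyOf {q : ℕ} (hq : 1 < q) {α : AC Fq} {P : Polynomial (Polynomial Fq)}
    (hP0 : P ≠ 0) (hP : evalPC Fq α P = 0) : ∃ F, IsMinPolyOf Fq α F := by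
  obtain ⟨f, hf, hf0⟩ : ∃ f : Polynomial (Polynomial Fq), Irreducible f ∧ evalPC Fq α f = 0 := by
    induction P using WfDvdMonoid.induction_on_irreducible with
    | zero => exact absurd rfl hP0
    | unit u hu =>
      have := hu.map (eval₂RingHom (ringHomTC Fq) α)
      rw [coe_eval₂RingHom] at this
      exact absurd hP this.ne_zero
    | mul a i ha hi ih =>
      rw [evalPC, eval₂_mul] at hP
      rcases mul_eq_zero.1 hP with h | h
      · exact ⟨i, hi, h⟩
      · exact ih ha h
  have hdeg : f.natDegree ≠ 0 := by
    intro h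
    obtain ⟨c, rfl⟩ := natDegree_eq_zero.1 h
    rw [evalPC, eval₂_C, map_eq_zero_iff _ (ringHomTC_injective hq)] at hf0
    exact hf.ne_zero (by simp [hf0])
  set a : Fq := f.leadingCoeff.leadingCoeff with ha
  have ha0 : a ≠ 0 := by simpa [ha] using hf.ne_zero
  set u : Polynomial (Polynomial Fq) := C (C a⁻¹) with hu
  have huu : IsUnit u := by
    rw [hu, isUnit_C, isUnit_C]; exact (inv_ne_zero ha0).isUnit
  have hirr : Irreducible (u * f) := (irreducible_isUnit_mul huu).2 hf
  have hdeg' : (u * f).natDegree = f.natDegree :=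
    natDegree_C_mul (by simpa using ha0)
  refine ⟨u * f, by omega, hirr, hirr.isPrimitive (by omega), ?_, ?_⟩
  · rw [Monic, leadingCoeff_mul, leadingCoeff_mul, ← ha, hu, leadingCoeff_C, leadingCoeff_C,
      inv_mul_cancel₀ ha0]
  · rw [evalPC] at hf0 ⊢
    rw [eval₂_mul, hf0, mul_zero]

/-- A root of a nonzero polynomial over `F_q[T]` has degree and height bounded by those of the
polynomial. -/
lemma isAlgT_of_root {q : ℕ} (hq : 1 < q) {v : AbsoluteValue (AC Fq) ℝ} (hna : IsNonarchimedean v)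
    (hext : ∀ x, v (iota Fq x) = absL Fq q x) {α : AC Fq} {P : Polynomial (Polynomial Fq)}
    (hP0 : P ≠ 0) (hP : evalPC Fq α P = 0) :
    IsAlgT Fq α ∧ degT Fq α ≤ P.natDegree ∧ 1 ≤ heightT Fq q α ∧
      heightT Fq q α ≤ heightP Fq q P := by
  have h : IsAlgT Fq α := exists_isMinPolyOf hq hP0 hP
  have hdvd := h.choose_spec.dvd hq hP
  refine ⟨h, ?_, ?_, ?_⟩
  · rw [degT, dif_pos h]; exact natDegree_le_of_dvd hdvd hP0
  · rw [heightT, dif_pos h]; exact one_le_heightP hq (ne_zero_of_dvd_ne_zero hP0 hdvd)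
  · rw [heightT, dif_pos h]; exact heightP_le_of_dvd hq hna hext hP0 hdvd

lemma resultant_ne_zero_of_not_dvd {P Q : Polynomial (Polynomial Fq)} (hP : Irreducible P)
    (hdeg : P.natDegree ≠ 0) (hPQ : ¬ P ∣ Q) : resultant P Q ≠ 0 := by
  let K := FractionRing (Polynomial Fq)
  have hinj : Function.Injective (algebraMap (Polynomial Fq) K) := IsFractionRing.injective _ _
  have hprim := hP.isPrimitive hdeg
  have hirr' := (hprim.irreducible_iff_irreducible_map_fraction_map (K := K)).1 hP
  rw [hprim.dvd_iff_fraction_map_dvd_fraction_map K] at hPQ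
  have := resultant_ne_zero _ _ ((hirr'.coprime_iff_not_dvd).2 hPQ)
  rw [natDegree_map_eq_of_injective hinj, natDegree_map_eq_of_injective hinj,
    resultant_map_map] at this
  exact fun h => this (by rw [h, map_zero])

lemma heightP_le_pow {q : ℕ} (hq : 1 < q) {P : Polynomial (Polynomial Fq)} {h : ℕ}
    (hP : ∀ i, (P.coeff i).natDegree ≤ h) : heightP Fq q P ≤ (q : ℝ) ^ h := by
  rw [heightP]
  split_ifs
  · positivity
  · exact pow_le_pow_right₀ (by exact_mod_cast hq.le) (Finset.sup_le fun i _ => hP i)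

/-- Minkowski's linear forms theorem for the powers of `ξ`. -/
lemma exists_evalP_small {q : ℕ} (hq : 1 < q) (n : ℕ) (ξ : LaurentSeries Fq) :
    ∃ c : ℝ, 0 < c ∧ ∀ h : ℕ, ∃ P : Polynomial (Polynomial Fq), P ≠ 0 ∧ P.natDegree ≤ n ∧
      heightP Fq q P ≤ (q : ℝ) ^ h ∧ absL Fq q (evalP Fq ξ P) * (q : ℝ) ^ (n * h) ≤ c := by
  have h1 : (1 : ℝ) < q := by exact_mod_cast hq
  obtain ⟨M, hM⟩ : ∃ M : ℕ, absL Fq q ξ ≤ (q : ℝ) ^ M :=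
    (pow_unbounded_of_one_lt _ h1).imp fun _ => le_of_lt
  refine ⟨(q : ℝ) ^ (n * M), by positivity, fun h => ?_⟩
  have hv : ∀ x, absLAV Fq hq x = absL Fq q x := fun _ => rfl
  have hT : absL Fq q (Tel Fq) = q := by
    have := absL_ringHomT hq (X_ne_zero (R := Fq))
    simpa [ringHomT] using this
  let E : (Fin (n + 1) × Fin (h + 1) → Fq) → LaurentSeries Fq :=
    fun c => ∑ ij, c ij • (Tel Fq ^ (ij.2 : ℕ) * ξ ^ (ij.1 : ℕ))
  have hlow : ∀ c, ∀ k : ℤ, k < -(h + n * M : ℕ) → (E c).coeff k = 0 := by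
    intro c k hk
    simp only [E, HahnSeries.coeff_sum, HahnSeries.coeff_smul]
    refine Finset.sum_eq_zero fun ij _ => ?_
    have : absL Fq q (Tel Fq ^ (ij.2 : ℕ) * ξ ^ (ij.1 : ℕ)) ≤
        (q : ℝ) ^ (-(-(h + n * M : ℕ) : ℤ)) := by
      rw [← hv, map_mul, map_pow, map_pow, hv, hv, hT, neg_neg, zpow_natCast, pow_add, mul_comm n,
        pow_mul]
      refine mul_le_mul (pow_le_pow_right₀ h1.le (by omega)) ?_
        (pow_nonneg (absL_nonneg q ξ) _) (by positivity)
      calc absL Fq q ξ ^ (ij.1 : ℕ) ≤ ((q : ℝ) ^ M) ^ (ij.1 : ℕ) := by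
            gcongr; exact absL_nonneg q _
        _ ≤ _ := pow_le_pow_right₀ (one_le_pow₀ h1.le) (by omega)
    rw [(absL_le_zpow_iff hq).1 this k hk, smul_zero]
  let L : (Fin (n + 1) × Fin (h + 1) → Fq) →ₗ[Fq] (Fin (n * h + n + h) → Fq) :=
    { toFun := fun c k => (E c).coeff (k - (h + n * M : ℕ))
      map_add' := fun c d => by
        ext k
        simp [E, add_mul, Finset.sum_add_distrib]
      map_smul' := fun a c => by
        ext k
        simp [E, Finset.mul_sum, mul_assoc] }
  have hker : LinearMap.ker L ≠ ⊥ := LinearMap.ker_ne_bot_of_finrank_lt (by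
    simp only [Module.finrank_fintype_fun_eq_card, Fintype.card_prod, Fintype.card_fin]
    nlinarith)
  obtain ⟨c, hc, hc0⟩ := (Submodule.ne_bot_iff _).1 hker
  have hEc : absL Fq q (E c) ≤ (q : ℝ) ^ (-((n * h + n : ℕ) - (n * M : ℕ) : ℤ)) := by
    rw [absL_le_zpow_iff hq]
    intro k hk
    rcases lt_or_ge k (-(h + n * M : ℕ)) with hk' | hk'
    · exact hlow c k hk'
    · have := congrFun (LinearMap.mem_ker.1 hc) ⟨(k + (h + n * M : ℕ)).toNat, by omega⟩
      simp only [L, LinearMap.coe_mk, AddHom.coe_mk, Pi.zero_apply] at this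
      rw [← this]
      congr 1
      omega
  let P : Polynomial (Polynomial Fq) := ∑ ij, monomial (ij.1 : ℕ) (monomial (ij.2 : ℕ) (c ij))
  have hcoeff : ∀ i : Fin (n + 1), P.coeff i = ∑ j : Fin (h + 1), monomial (j : ℕ) (c (i, j)) := by
    intro i
    simp only [P, finsetSum_coeff, Fintype.sum_prod_type, coeff_monomial, Fin.val_inj]
    rw [Finset.sum_eq_single i] <;> simp +contextual
  have hcoeff' : ∀ (i : Fin (n + 1)) (j : Fin (h + 1)), (P.coeff i).coeff j = c (i, j) := by
    intro i j
    simp only [hcoeff, finsetSum_coeff, coeff_monomial, Fin.val_inj]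
    simp
  have hdeg : P.natDegree ≤ n :=
    natDegree_sum_le_of_forall_le _ _ fun ij _ => (natDegree_monomial_le _).trans (by omega)
  refine ⟨P, ?_, hdeg, heightP_le_pow hq fun i => ?_, ?_⟩
  · rintro hP
    refine hc0 (funext fun ij => ?_)
    have := hcoeff' ij.1 ij.2
    rw [hP] at this
    simpa using this.symm
  · rcases le_or_gt i n with hi | hi
    · rw [hcoeff ⟨i, by omega⟩]
      exact natDegree_sum_le_of_forall_le _ _ fun j _ => (natDegree_monomial_le _).trans (by omega)
    · simp [coeff_eq_zero_of_natDegree_lt (hdeg.trans_lt hi)]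
  · have hPE : evalP Fq ξ P = E c := by
      simp only [evalP, P, E, eval₂_finsetSum, eval₂_monomial]
      refine Finset.sum_congr rfl fun ij _ => ?_
      rw [ringHomT, coe_eval₂RingHom, eval₂_monomial, mul_assoc, HahnSeries.C_mul_eq_smul]
    rw [hPE]
    calc absL Fq q (E c) * (q : ℝ) ^ (n * h)
        ≤ (q : ℝ) ^ (-((n * h + n : ℕ) - (n * M : ℕ) : ℤ)) * (q : ℝ) ^ (n * h) := by gcongr
      _ = (q : ℝ) ^ ((n * M : ℕ) - n : ℤ) := by
          rw [← zpow_natCast, ← zpow_add₀ (by positivity)]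
          congr 1
          push_cast
          ring
      _ ≤ (q : ℝ) ^ ((n * M : ℕ) : ℤ) := zpow_le_zpow_right₀ h1.le (by omega)
      _ = _ := zpow_natCast _ _

lemma finite_natDegree_le_coeff_mem {R : Type*} [Semiring R] {S : Set R} (hS : S.Finite) (n : ℕ) :
    {P : R[X] | P.natDegree ≤ n ∧ ∀ i, P.coeff i ∈ S}.Finite := by
  refine Set.Finite.of_injOn (f := fun P (i : Fin (n + 1)) => P.coeff i)
    (t := Set.univ.pi fun _ => S) ?_ ?_ (Set.Finite.pi fun _ => hS)
  · rintro P ⟨-, hP⟩ i -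
    exact hP i
  · rintro P ⟨hP, -⟩ Q ⟨hQ, -⟩ hPQ
    ext i
    rcases le_or_gt i n with hi | hi
    · exact congrFun hPQ ⟨i, by omega⟩
    · rw [coeff_eq_zero_of_natDegree_lt (hP.trans_lt hi),
        coeff_eq_zero_of_natDegree_lt (hQ.trans_lt hi)]

lemma finite_heightP_le [Fintype Fq] {q : ℕ} (hq : 1 < q) (n : ℕ) (B : ℝ) :
    {P : Polynomial (Polynomial Fq) | P.natDegree ≤ n ∧ heightP Fq q P ≤ B}.Finite := by
  have h1 : (1 : ℝ) < q := by exact_mod_cast hq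
  obtain ⟨h, hB⟩ := pow_unbounded_of_one_lt B h1
  have hS : {c : Polynomial Fq | c.natDegree ≤ h ∧ ∀ i, c.coeff i ∈ (Set.univ : Set Fq)}.Finite :=
    finite_natDegree_le_coeff_mem Set.finite_univ h
  refine (finite_natDegree_le_coeff_mem hS n).subset ?_
  rintro P ⟨hP, hPB⟩
  refine ⟨hP, fun i => ⟨?_, fun _ => Set.mem_univ _⟩⟩
  by_cases hi : P.coeff i = 0
  · simp [hi]
  have hP0 : P ≠ 0 := by rintro rfl; simp at hi
  rw [heightP, if_neg hP0] at hPB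
  refine (Finset.le_sup (f := fun i => (P.coeff i).natDegree) (mem_support_iff.2 hi)).trans ?_
  exact ((pow_lt_pow_iff_right₀ h1).1 (hPB.trans_lt hB)).le

lemma _root_.Set.Finite.exists_pos_forall_le {ι : Type*} {s : Set ι} (hs : s.Finite) {f : ι → ℝ}
    (hf : ∀ x ∈ s, 0 < f x) : ∃ δ : ℝ, 0 < δ ∧ ∀ x ∈ s, δ ≤ f x := by
  rcases s.eq_empty_or_nonempty with rfl | hne
  · exact ⟨1, one_pos, by simp⟩
  · obtain ⟨a, ha, hmin⟩ := Set.exists_min_image s f hs hne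
    exact ⟨f a, hf a ha, hmin⟩

/-- The values at `ξ` of the nonzero polynomials of bounded degree and height are bounded below. -/
lemma exists_le_absL_evalP [Fintype Fq] {q : ℕ} (hq : 1 < q) {n : ℕ} {ξ : LaurentSeries Fq}
    (hξ : ∀ P : Polynomial (Polynomial Fq), P ≠ 0 → P.natDegree ≤ n → evalP Fq ξ P ≠ 0) (B : ℝ) :
    ∃ δ : ℝ, 0 < δ ∧ ∀ P : Polynomial (Polynomial Fq), P ≠ 0 → P.natDegree ≤ n →
      heightP Fq q P ≤ B → δ ≤ absL Fq q (evalP Fq ξ P) := by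
  obtain ⟨δ, hδ, h⟩ := ((finite_heightP_le (Fq := Fq) hq n B).subset
    (Set.sep_subset _ fun P => P ≠ 0)).exists_pos_forall_le
    (f := fun P => absL Fq q (evalP Fq ξ P)) fun P hP => absL_pos hq (hξ P hP.2 hP.1.1)
  exact ⟨δ, hδ, fun P h0 hP hB => h P ⟨⟨hP, hB⟩, h0⟩⟩

lemma one_le_absL_evalP_of_natDegree_eq_zero {q : ℕ} (hq : 1 < q) (ξ : LaurentSeries Fq)
    {P : Polynomial (Polynomial Fq)} (hP : P ≠ 0) (hdeg : P.natDegree = 0) :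
    1 ≤ absL Fq q (evalP Fq ξ P) := by
  obtain ⟨c, rfl⟩ := natDegree_eq_zero.1 hdeg
  rw [evalP, eval₂_C, absL_ringHomT hq (by simpa using hP)]
  exact one_le_pow₀ (by exact_mod_cast hq.le)

/-- There are irreducible polynomials of arbitrarily large height taking small values at `ξ`. -/
lemma exists_irreducible_evalP_small [Fintype Fq] {q : ℕ} (hq : 1 < q) {n : ℕ}
    {ξ : LaurentSeries Fq}
    (hξ : ∀ P : Polynomial (Polynomial Fq), P ≠ 0 → P.natDegree ≤ n → evalP Fq ξ P ≠ 0)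
    {w : ℝ} (hw0 : 0 ≤ w) (hw : w < n) (B : ℝ) :
    ∃ P : Polynomial (Polynomial Fq), Irreducible P ∧ P.natDegree ≤ n ∧
      B < heightP Fq q P ∧ absL Fq q (evalP Fq ξ P) ≤ heightP Fq q P ^ (-w) := by
  have h1 : (1 : ℝ) < q := by exact_mod_cast hq
  obtain ⟨v, hna, -, hext⟩ := exists_absC_eq (Fq := Fq) hq
  by_contra! hcon
  obtain ⟨δ, hδ, hδB⟩ := exists_le_absL_evalP hq hξ B
  set d := min δ 1 with hd
  have hd0 : 0 < d := lt_min hδ one_pos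
  have hd1 : d ≤ 1 := min_le_right _ _
  have hH : ∀ P : Polynomial (Polynomial Fq), P ≠ 0 → 1 ≤ heightP Fq q P ^ w := fun P hP =>
    Real.one_le_rpow (one_le_heightP hq hP) hw0
  have hconst : ∀ P : Polynomial (Polynomial Fq), P ≠ 0 → P.natDegree = 0 →
      d ^ P.natDegree ≤ absL Fq q (evalP Fq ξ P) * heightP Fq q P ^ w := by
    intro P hP hdeg
    rw [hdeg, pow_zero]
    exact one_le_mul_of_one_le_of_one_le (one_le_absL_evalP_of_natDegree_eq_zero hq ξ hP hdeg)
      (hH P hP)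
  have hirr : ∀ P : Polynomial (Polynomial Fq), Irreducible P → P.natDegree ≤ n →
      d ^ P.natDegree ≤ absL Fq q (evalP Fq ξ P) * heightP Fq q P ^ w := by
    intro P hP hPn
    by_cases hdeg : P.natDegree = 0
    · exact hconst P hP.ne_zero hdeg
    refine (pow_le_of_le_one hd0.le hd1 hdeg).trans ?_
    rcases le_or_gt (heightP Fq q P) B with hB | hB
    · calc d ≤ δ := min_le_left _ _
        _ ≤ absL Fq q (evalP Fq ξ P) := hδB P hP.ne_zero hPn hB
        _ ≤ _ := le_mul_of_one_le_right (absL_nonneg q _) (hH P hP.ne_zero)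
    · have hpos : 0 < heightP Fq q P := one_pos.trans_le (one_le_heightP hq hP.ne_zero)
      calc d ≤ 1 := hd1
        _ = heightP Fq q P ^ (-w) * heightP Fq q P ^ w := by
          rw [← Real.rpow_add hpos, neg_add_cancel, Real.rpow_zero]
        _ ≤ _ := by
          have := (hcon P hP hPn hB).le
          gcongr
  have hall : ∀ P : Polynomial (Polynomial Fq), P ≠ 0 → P.natDegree ≤ n →
      d ^ P.natDegree ≤ absL Fq q (evalP Fq ξ P) * heightP Fq q P ^ w := by
    intro P
    induction P using WfDvdMonoid.induction_on_irreducible with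
    | zero => exact fun h => absurd rfl h
    | unit u hu => exact fun h _ => hconst u h (natDegree_eq_zero_of_isUnit hu)
    | mul a i ha hi ih =>
      intro _ hn
      rw [natDegree_mul hi.ne_zero ha] at hn ⊢
      rw [evalP, eval₂_mul, absL_mul hq, heightP_mul hq hna hext,
        Real.mul_rpow (zero_le_one.trans (one_le_heightP hq hi.ne_zero))
          (zero_le_one.trans (one_le_heightP hq ha)), pow_add, mul_mul_mul_comm]
      exact mul_le_mul (hirr i hi (by omega)) (ih ha (by omega)) (by positivity)
        ((pow_pos hd0 _).le.trans (hirr i hi (by omega)))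
  obtain ⟨c, hc, hmink⟩ := exists_evalP_small (Fq := Fq) hq n ξ
  obtain ⟨h, hh⟩ := pow_unbounded_of_one_lt (c / d ^ n) (Real.one_lt_rpow h1 (sub_pos.2 hw))
  obtain ⟨P, hP0, hPn, hPh, hP⟩ := hmink h
  have hlow : d ^ n ≤ absL Fq q (evalP Fq ξ P) * ((q : ℝ) ^ h) ^ w :=
    calc d ^ n ≤ d ^ P.natDegree := pow_le_pow_of_le_one hd0.le hd1 hPn
      _ ≤ _ := hall P hP0 hPn
      _ ≤ _ := by
        gcongr
        · exact absL_nonneg q _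
        · exact zero_le_one.trans (one_le_heightP hq hP0)
  rw [div_lt_iff₀ (by positivity)] at hh
  have hq0 : (0 : ℝ) < q := by positivity
  have key : ((q : ℝ) ^ ((n : ℝ) - w)) ^ h * ((q : ℝ) ^ h) ^ w = (q : ℝ) ^ (n * h) := by
    rw [← Real.rpow_natCast, ← Real.rpow_natCast, ← Real.rpow_natCast, ← Real.rpow_mul hq0.le,
      ← Real.rpow_mul hq0.le, ← Real.rpow_add hq0]
    congr 1
    push_cast
    ring
  have : ((q : ℝ) ^ ((n : ℝ) - w)) ^ h * d ^ n ≤ c :=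
    calc _ ≤ ((q : ℝ) ^ ((n : ℝ) - w)) ^ h *
          (absL Fq q (evalP Fq ξ P) * ((q : ℝ) ^ h) ^ w) := by gcongr
      _ = absL Fq q (evalP Fq ξ P) * (q : ℝ) ^ (n * h) := by rw [← key]; ring
      _ ≤ c := hP
  exact absurd this hh.not_ge

lemma le_wn [Fintype Fq] {q : ℕ} (hq : 1 < q) {n : ℕ} {ξ : LaurentSeries Fq}
    (hξ : ∀ P : Polynomial (Polynomial Fq), P ≠ 0 → P.natDegree ≤ n → evalP Fq ξ P ≠ 0)
    {w : ℝ} (hw0 : 0 ≤ w) (hw : w < n) : (w : EReal) ≤ wn Fq q n ξ := by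
  refine le_sSup ⟨w, fun hfin => ?_, rfl⟩
  obtain ⟨B, hB⟩ := (hfin.image (heightP Fq q)).bddAbove
  obtain ⟨P, hP, hPn, hPB, hPw⟩ := exists_irreducible_evalP_small hq hξ hw0 hw B
  exact hPB.not_ge (hB ⟨P, ⟨hPn, absL_pos hq (hξ P hP.ne_zero hPn), hPw⟩, rfl⟩)

lemma _root_.EReal.coe_le_of_forall_lt {a b : ℝ} {x : EReal} (hab : a < b)
    (h : ∀ w : ℝ, a ≤ w → w < b → (w : EReal) ≤ x) : (b : EReal) ≤ x := by
  refine le_of_forall_lt fun y hy => ?_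
  obtain ⟨z, hyz, hzb⟩ := EReal.lt_iff_exists_real_btwn.1 (max_lt hy (EReal.coe_lt_coe_iff.2 hab))
  exact ((le_max_left _ _).trans_lt hyz).trans_le
    (h z (EReal.coe_le_coe_iff.1 ((le_max_right _ _).trans hyz.le)) (EReal.coe_lt_coe_iff.1 hzb))

lemma min_sum_le_sum_min {ι κ : Type*} (s : Finset ι) (t : Finset κ) {x : ι → ℝ} {y : κ → ℝ}
    (hx : ∀ i, 0 ≤ x i) (hy : ∀ j, 0 ≤ y j) :
    min (∑ i ∈ s, x i) (∑ j ∈ t, y j) ≤ ∑ i ∈ s, ∑ j ∈ t, min (x i) (y j) := by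
  have hmin : ∀ i j, 0 ≤ min (x i) (y j) := fun i j => le_min (hx i) (hy j)
  by_cases h : ∃ i ∈ s, ∀ j ∈ t, y j ≤ x i
  · obtain ⟨i, hi, hij⟩ := h
    calc min (∑ i ∈ s, x i) (∑ j ∈ t, y j) ≤ ∑ j ∈ t, y j := min_le_right _ _
      _ = ∑ j ∈ t, min (x i) (y j) :=
        Finset.sum_congr rfl fun j hj => (min_eq_right (hij j hj)).symm
      _ ≤ _ := Finset.single_le_sum (f := fun i => ∑ j ∈ t, min (x i) (y j))
        (fun i _ => Finset.sum_nonneg fun j _ => hmin i j) hi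
  · push Not at h
    refine (min_le_left _ _).trans (Finset.sum_le_sum fun i hi => ?_)
    obtain ⟨j, hj, hij⟩ := h i hi
    calc x i = min (x i) (y j) := (min_eq_left hij.le).symm
      _ ≤ _ := Finset.single_le_sum (f := fun j => min (x i) (y j)) (fun j _ => hmin i j) hj

lemma sum_min_lower_bound {ι κ : Type*} [Fintype ι] [Fintype κ] {x : ι → ℝ} {y : κ → ℝ}
    (hx : ∀ i, 0 ≤ x i) (hy : ∀ j, 0 ≤ y j) {a : ι} {b : κ} (hb : ∀ j, y j ≤ y b)
    (hab : y b ≤ x a) :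
    2 * ∑ j, y j ≤ ∑ i, ∑ j, min (x i) (y j) ∨
      ∑ j, y j + (∑ i, x i - x a) + min (∑ i, x i - x a) (∑ j, y j - y b) ≤
        ∑ i, ∑ j, min (x i) (y j) := by
  have hmin : ∀ i j, 0 ≤ min (x i) (y j) := fun i j => le_min (hx i) (hy j)
  have hrow : ∀ i, y b ≤ x i → ∑ j, min (x i) (y j) = ∑ j, y j := fun i hi =>
    Finset.sum_congr rfl fun j _ => min_eq_right ((hb j).trans hi)
  rw [← Finset.add_sum_erase _ (fun i => ∑ j, min (x i) (y j)) (Finset.mem_univ a), hrow a hab]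
  by_cases h : ∃ i, i ≠ a ∧ y b ≤ x i
  · left
    obtain ⟨i, hia, hi⟩ := h
    have := Finset.single_le_sum (f := fun i => ∑ j, min (x i) (y j)) (s := Finset.univ.erase a)
      (fun i _ => Finset.sum_nonneg fun j _ => hmin i j)
      (Finset.mem_erase.2 ⟨hia, Finset.mem_univ i⟩)
    simp only [hrow i hi] at this
    linarith
  · right
    push Not at h
    have hxa := Finset.add_sum_erase _ x (Finset.mem_univ a)
    have hyb := Finset.add_sum_erase _ y (Finset.mem_univ b)
    have hcol : ∑ i ∈ Finset.univ.erase a, ∑ j, min (x i) (y j) =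
        ∑ i ∈ Finset.univ.erase a, x i +
          ∑ i ∈ Finset.univ.erase a, ∑ j ∈ Finset.univ.erase b, min (x i) (y j) := by
      rw [← Finset.sum_add_distrib]
      refine Finset.sum_congr rfl fun i hi => ?_
      rw [← Finset.add_sum_erase _ (fun j => min (x i) (y j)) (Finset.mem_univ b),
        min_eq_left (h i (Finset.ne_of_mem_erase hi)).le]
    have := min_sum_le_sum_min (Finset.univ.erase a) (Finset.univ.erase b) hx hy
    rw [hcol, show ∑ i, x i - x a = ∑ i ∈ Finset.univ.erase a, x i by linarith,
      show ∑ j, y j - y b = ∑ j ∈ Finset.univ.erase b, y j by linarith]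
    linarith

/-- The numerical heart of the lower bound for `w_n*`: logarithmic distances `x`, `y` from `ξ` to
the roots of two coprime polynomials of logarithmic heights `h' ≤ h` cannot all be small. -/
lemma mul_le_of_sum_min_le {ι κ : Type*} [Fintype ι] [Fintype κ] {x : ι → ℝ} {y : κ → ℝ}
    (hx : ∀ i, 0 ≤ x i) (hy : ∀ j, 0 ≤ y j) {n h h' η E : ℝ} (hn : 1 ≤ n) (hh' : 0 ≤ h')
    (hhh : h' ≤ h) (hη : 0 < η) (hη1 : η ≤ 1)
    (hS : (n + 1 - η / 4) * h - E ≤ ∑ i, x i) (hR : n * h + h' - E ≤ ∑ j, y j)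
    (hxA : ∀ i, x i ≤ ((n + 3) / 2 - η) * h) (hyA : ∀ j, y j ≤ ((n + 3) / 2 - η) * h')
    (hmin : ∑ i, ∑ j, min (x i) (y j) ≤ n * (h + h') + E) : η * h ≤ 8 * E := by
  have hh : 0 ≤ h := hh'.trans hhh
  have hηh : η * h ≤ h := mul_le_of_le_one_left hh hη1
  have hηh' : 0 ≤ η * h := by positivity
  have hd : 0 ≤ (n - 1) * (h - h') := mul_nonneg (by linarith) (by linarith)
  have hnh : 0 ≤ (n - 1) * h := mul_nonneg (by linarith) hh
  have hηd : η * (h - h') ≤ h - h' := mul_le_of_le_one_left (by linarith) hη1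
  rcases isEmpty_or_nonempty ι with hι | hι
  · rw [Finset.univ_eq_empty, Finset.sum_empty] at hS
    nlinarith
  rcases isEmpty_or_nonempty κ with hκ | hκ
  · rw [Finset.univ_eq_empty, Finset.sum_empty] at hR
    nlinarith
  obtain ⟨a, ha⟩ := Finite.exists_max x
  obtain ⟨b, hb⟩ := Finite.exists_max y
  have hxa := hxA a
  have hyb := hyA b
  rcases le_total (y b) (x a) with hab | hab
  · rcases sum_min_lower_bound hx hy hb hab with H | H
    · nlinarith
    · rcases min_cases (∑ i, x i - x a) (∑ j, y j - y b) with ⟨hm, -⟩ | ⟨hm, -⟩ <;>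
        rw [hm] at H <;> nlinarith
  · have hcomm : ∑ j, ∑ i, min (y j) (x i) = ∑ i, ∑ j, min (x i) (y j) := by
      rw [Finset.sum_comm]
      simp only [min_comm]
    rcases sum_min_lower_bound hy hx ha hab with H | H <;> rw [hcomm] at H
    · nlinarith
    · rcases min_cases (∑ j, y j - y b) (∑ i, x i - x a) with ⟨hm, -⟩ | ⟨hm, -⟩ <;>
        rw [hm] at H <;> nlinarith

/-- The logarithmic height, centred at `ξ`, of a polynomial with leading coefficient `c` and
roots `r`. -/
def logHeightAt {ι : Type*} [Fintype ι] (q : ℕ) (v : AbsoluteValue (AC Fq) ℝ) (ξ c : AC Fq)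
    (r : ι → AC Fq) : ℝ :=
  Real.logb q (v c) + ∑ i, max 0 (Real.logb q (v (ξ - r i)))

lemma logb_eval_eq {ι : Type*} [Fintype ι] (q : ℕ) (v : AbsoluteValue (AC Fq) ℝ) {ξ c : AC Fq}
    {r : ι → AC Fq} (hc : c ≠ 0) (hr : ∀ i, ξ - r i ≠ 0) :
    Real.logb q (v c * ∏ i, v (ξ - r i)) =
      logHeightAt q v ξ c r - ∑ i, max 0 (-Real.logb q (v (ξ - r i))) := by
  rw [Real.logb_mul (v.ne_zero hc) (Finset.prod_ne_zero_iff.2 fun i _ => v.ne_zero (hr i)),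
    Real.logb_prod _ _ fun i _ => v.ne_zero (hr i), logHeightAt, add_sub_assoc,
    ← Finset.sum_sub_distrib]
  congr 1
  refine Finset.sum_congr rfl fun i _ => ?_
  rcases le_total 0 (Real.logb q (v (ξ - r i))) with h | h
  · rw [max_eq_right h, max_eq_left (by linarith), sub_zero]
  · rw [max_eq_left h, max_eq_right (by linarith), zero_sub, neg_neg]

lemma _root_.IsNonarchimedean.abv_sub_le {K : Type*} [Field K] {v : AbsoluteValue K ℝ}
    (hna : IsNonarchimedean v) (x y : K) : v (x - y) ≤ max (v x) (v y) := by
  rw [sub_eq_add_neg, ← v.map_neg y]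
  exact hna x (-y)

lemma _root_.Real.max_zero_logb {b x : ℝ} (hb : 1 < b) (hx : 0 < x) :
    max 0 (Real.logb b x) = Real.logb b (max 1 x) := by
  rcases le_total 1 x with h | h
  · rw [max_eq_right h, max_eq_right (Real.logb_nonneg hb h)]
  · rw [max_eq_left h, Real.logb_one, max_eq_left (Real.logb_nonpos hb hx.le h)]

lemma abs_logb_sub_logb_le {q : ℕ} (hq : 1 < q) {v : AbsoluteValue (AC Fq) ℝ}
    (hna : IsNonarchimedean v) {ξ r : AC Fq} (hr : ξ - r ≠ 0) :
    |max 0 (Real.logb q (v (ξ - r))) - Real.logb q (max 1 (v r))| ≤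
      Real.logb q (max 1 (v ξ)) := by
  have h1 : (1 : ℝ) < q := by exact_mod_cast hq
  have hpos : ∀ t : ℝ, 0 < max 1 t := fun t => one_pos.trans_le (le_max_left 1 t)
  have key : ∀ x : AC Fq,
      Real.logb q (max 1 (v (ξ - x))) ≤ Real.logb q (max 1 (v ξ)) + Real.logb q (max 1 (v x)) := by
    intro x
    rw [← Real.logb_mul (hpos _).ne' (hpos _).ne']
    refine Real.logb_le_logb_of_le h1 (hpos _)
      (max_le ?_ ((hna.abv_sub_le ξ x).trans (max_le ?_ ?_)))
    · exact one_le_mul_of_one_le_of_one_le (le_max_left _ _) (le_max_left _ _)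
    · exact (le_max_right _ _).trans (le_mul_of_one_le_right (hpos _).le (le_max_left _ _))
    · exact (le_max_right _ _).trans (le_mul_of_one_le_left (hpos _).le (le_max_left _ _))
  rw [Real.max_zero_logb h1 (v.pos hr), abs_sub_le_iff]
  have h₂ := key (ξ - r)
  rw [sub_sub_cancel] at h₂
  exact ⟨by linarith [key r], by linarith⟩

lemma abs_logHeightAt_sub_le {q : ℕ} (hq : 1 < q) {v : AbsoluteValue (AC Fq) ℝ}
    (hna : IsNonarchimedean v) {m n : ℕ} (hmn : m ≤ n) {ξ c : AC Fq} {r : Fin m → AC Fq}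
    (hc : c ≠ 0) (hr : ∀ i, ξ - r i ≠ 0) :
    |logHeightAt q v ξ c r - Real.logb q (v c * ∏ i, max 1 (v (r i)))| ≤
      n * Real.logb q (max 1 (v ξ)) := by
  have h1 : (1 : ℝ) < q := by exact_mod_cast hq
  have hpos : ∀ t : ℝ, max 1 t ≠ 0 := fun t => (one_pos.trans_le (le_max_left 1 t)).ne'
  rw [Real.logb_mul (v.ne_zero hc) (Finset.prod_ne_zero_iff.2 fun i _ => hpos _),
    Real.logb_prod _ _ fun i _ => hpos _, logHeightAt, add_sub_add_left_eq_sub,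
    ← Finset.sum_sub_distrib]
  refine (Finset.abs_sum_le_sum_abs _ _).trans
    ((Finset.sum_le_sum fun i _ => abs_logb_sub_logb_le hq hna (hr i)).trans ?_)
  rw [Finset.sum_const, Finset.card_fin, nsmul_eq_mul]
  have := Real.logb_nonneg h1 (le_max_left 1 (v ξ))
  gcongr

/-- The nonvanishing of the resultant bounds how close the roots of two coprime polynomials can
simultaneously be to `ξ`. -/
lemma sum_min_le_of_resultant {q : ℕ} (hq : 1 < q) {v : AbsoluteValue (AC Fq) ℝ}
    (hna : IsNonarchimedean v) {m k : ℕ} {ξ c d : AC Fq} {r : Fin m → AC Fq} {s : Fin k → AC Fq}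
    (hc : c ≠ 0) (hd : d ≠ 0)
    (hres : 1 ≤ v c ^ k * v d ^ m * ∏ i, ∏ j, v (r i - s j)) :
    ∑ i, ∑ j, min (max 0 (-Real.logb q (v (ξ - r i)))) (max 0 (-Real.logb q (v (ξ - s j)))) ≤
      k * logHeightAt q v ξ c r + m * logHeightAt q v ξ d s := by
  have h1 : (1 : ℝ) < q := by exact_mod_cast hq
  have hprod : ∏ i, ∏ j, v (r i - s j) ≠ 0 := by
    intro h
    rw [h, mul_zero] at hres
    exact absurd hres (by norm_num)
  have hrs : ∀ i j, v (r i - s j) ≠ 0 := fun i j =>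
    Finset.prod_ne_zero_iff.1 (Finset.prod_ne_zero_iff.1 hprod i (Finset.mem_univ i)) j
      (Finset.mem_univ j)
  have hterm : ∀ i j, Real.logb q (v (r i - s j)) ≤
      max 0 (Real.logb q (v (ξ - r i))) + max 0 (Real.logb q (v (ξ - s j))) -
        min (max 0 (-Real.logb q (v (ξ - r i)))) (max 0 (-Real.logb q (v (ξ - s j)))) := by
    intro i j
    have hle : v (r i - s j) ≤ max (v (ξ - s j)) (v (ξ - r i)) := by
      have := hna.abv_sub_le (ξ - s j) (ξ - r i)
      rwa [sub_sub_sub_cancel_left] at this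
    have hlog : Real.logb q (v (r i - s j)) ≤
        max (Real.logb q (v (ξ - s j))) (Real.logb q (v (ξ - r i))) := by
      have hp : 0 < v (r i - s j) := lt_of_le_of_ne (v.nonneg _) (hrs i j).symm
      rcases le_max_iff.1 hle with h | h
      · exact (Real.logb_le_logb_of_le h1 hp h).trans (le_max_left _ _)
      · exact (Real.logb_le_logb_of_le h1 hp h).trans (le_max_right _ _)
    grind
  have hlog := Real.logb_nonneg h1 hres
  rw [Real.logb_mul
      (mul_ne_zero (pow_ne_zero _ (v.ne_zero hc)) (pow_ne_zero _ (v.ne_zero hd))) hprod,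
    Real.logb_mul (pow_ne_zero _ (v.ne_zero hc)) (pow_ne_zero _ (v.ne_zero hd)), Real.logb_pow,
    Real.logb_pow,
    Real.logb_prod _ _ fun i _ => Finset.prod_ne_zero_iff.2 fun j _ => hrs i j] at hlog
  simp only [Real.logb_prod _ _ fun j _ => hrs _ j] at hlog
  have hsum := Finset.sum_le_sum fun i (_ : i ∈ Finset.univ) =>
    Finset.sum_le_sum fun j (_ : j ∈ Finset.univ) => hterm i j
  simp only [Finset.sum_sub_distrib, Finset.sum_add_distrib, Finset.sum_const, Finset.card_fin,
    nsmul_eq_mul, ← Finset.mul_sum] at hsum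
  simp only [logHeightAt, mul_add]
  linarith

lemma evalPC_root {P : Polynomial (Polynomial Fq)} {r : Fin P.natDegree → AC Fq}
    (hr : P.map (ringHomTC Fq) = C (ringHomTC Fq P.leadingCoeff) * ∏ i, (X - C (r i)))
    (i : Fin P.natDegree) : evalPC Fq (r i) P = 0 := by
  rw [evalPC, ← eval_map, hr, eval_mul, eval_prod,
    Finset.prod_eq_zero (Finset.mem_univ i) (by simp), mul_zero]

lemma iota_sub_ne_zero_of_root {ξ : LaurentSeries Fq} {P : Polynomial (Polynomial Fq)}
    (hP : evalP Fq ξ P ≠ 0) {α : AC Fq} (hα : evalPC Fq α P = 0) : iota Fq ξ - α ≠ 0 := by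
  intro h
  rw [← sub_eq_zero.1 h, evalPC_iota, map_eq_zero_iff _ (RingHom.injective (iota Fq))] at hα
  exact hP hα

/-- If `ξ` has only finitely many approximations of quality `w`, then roots of polynomials of large
height are not close to `ξ`. -/
lemma exists_rpow_le_of_finite {q : ℕ} (hq : 1 < q) {v : AbsoluteValue (AC Fq) ℝ}
    (hna : IsNonarchimedean v) (hv : ∀ x, v x = absC Fq q x)
    (hext : ∀ x, v (iota Fq x) = absL Fq q x) {n : ℕ} {ξ : LaurentSeries Fq}
    (hξ : ∀ P : Polynomial (Polynomial Fq), P ≠ 0 → P.natDegree ≤ n → evalP Fq ξ P ≠ 0)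
    {w : ℝ} (hw : 0 < w + 1)
    (hfin : {α : AC Fq | IsAlgT Fq α ∧ degT Fq α ≤ n ∧ 0 < absC Fq q (iota Fq ξ - α) ∧
      absC Fq q (iota Fq ξ - α) ≤ heightT Fq q α ^ (-w - 1)}.Finite) :
    ∃ B : ℝ, ∀ P : Polynomial (Polynomial Fq), P ≠ 0 → P.natDegree ≤ n → B < heightP Fq q P →
      ∀ α, evalPC Fq α P = 0 → heightP Fq q P ^ (-(w + 1)) ≤ v (iota Fq ξ - α) := by
  obtain ⟨δ, hδ, hδα⟩ := hfin.exists_pos_forall_le (f := fun α => absC Fq q (iota Fq ξ - α))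
    fun α hα => hα.2.2.1
  obtain ⟨B, hB⟩ := Filter.eventually_atTop.1
    ((tendsto_rpow_neg_atTop hw).eventually (gt_mem_nhds hδ))
  refine ⟨B, fun P hP hPn hPB α hα => ?_⟩
  by_contra! hlt
  obtain ⟨halg, hdeg, hone, hheight⟩ := isAlgT_of_root hq hna hext hP hα
  have hmem := hδα α ⟨halg, hdeg.trans hPn, ?_, ?_⟩
  · rw [← hv] at hmem
    exact (hmem.trans_lt hlt).not_ge (hB _ hPB.le).le
  · rw [← hv]
    exact v.pos (iota_sub_ne_zero_of_root (hξ P hP hPn) hα)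
  · rw [← hv, show -w - 1 = -(w + 1) by ring]
    exact hlt.le.trans
      (Real.rpow_le_rpow_of_nonpos (one_pos.trans_le hone) hheight (by linarith))

lemma max_zero_neg_logb_le {b x H A : ℝ} (hb : 1 < b) (hH : 1 ≤ H) (hA : 0 ≤ A)
    (hx : H ^ (-A) ≤ x) : max 0 (-Real.logb b x) ≤ A * Real.logb b H := by
  refine max_le (mul_nonneg hA (Real.logb_nonneg hb hH)) ?_
  have hH0 : 0 < H := one_pos.trans_le hH
  have := Real.logb_le_logb_of_le hb (Real.rpow_pos_of_pos hH0 _) hx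
  rw [Real.logb_rpow_eq_mul_logb_of_pos hH0] at this
  linarith

/-- Two polynomials `P`, `Q` without common root and small at `ξ`, whose roots are not too close to
`ξ`, have bounded height. -/
lemma logb_heightP_bounded {q : ℕ} (hq : 1 < q) {v : AbsoluteValue (AC Fq) ℝ}
    (hna : IsNonarchimedean v) (hext : ∀ x, v (iota Fq x) = absL Fq q x) {n : ℕ} (hn : 1 ≤ n)
    {ξ : LaurentSeries Fq}
    (hξ : ∀ P : Polynomial (Polynomial Fq), P ≠ 0 → P.natDegree ≤ n → evalP Fq ξ P ≠ 0)
    {w η e : ℝ} (hη : 0 < η) (hη1 : η ≤ 1) (hw : w + 1 = (n + 3) / 2 - η) (he : 0 ≤ e)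
    {P Q : Polynomial (Polynomial Fq)} (hP0 : P ≠ 0) (hQ0 : Q ≠ 0) (hPn : P.natDegree ≤ n)
    (hQn : Q.natDegree ≤ n) (hPQ : resultant P Q ≠ 0)
    (hQP : heightP Fq q Q ≤ heightP Fq q P)
    (hP : absL Fq q (evalP Fq ξ P) ≤ heightP Fq q P ^ (-((n : ℝ) - η / 4)))
    (hQ : Real.logb q (absL Fq q (evalP Fq ξ Q)) ≤ -(n * Real.logb q (heightP Fq q P)) + e)
    (hPα : ∀ α, evalPC Fq α P = 0 → heightP Fq q P ^ (-(w + 1)) ≤ v (iota Fq ξ - α))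
    (hQα : ∀ α, evalPC Fq α Q = 0 → heightP Fq q Q ^ (-(w + 1)) ≤ v (iota Fq ξ - α)) :
    η * Real.logb q (heightP Fq q P) ≤
      8 * (2 * n * (n * Real.logb q (max 1 (absL Fq q ξ))) + e) := by
  have h1 : (1 : ℝ) < q := by exact_mod_cast hq
  have hn' : (1 : ℝ) ≤ n := by exact_mod_cast hn
  have hHP := one_le_heightP hq hP0
  have hHQ := one_le_heightP hq hQ0
  obtain ⟨r, hr⟩ := exists_roots (Fq := Fq) hq P
  obtain ⟨s, hs⟩ := exists_roots (Fq := Fq) hq Q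
  have hr0 := fun i => iota_sub_ne_zero_of_root (hξ P hP0 hPn) (evalPC_root hr i)
  have hs0 := fun i => iota_sub_ne_zero_of_root (hξ Q hQ0 hQn) (evalPC_root hs i)
  have hlead : ∀ R : Polynomial (Polynomial Fq), R ≠ 0 → ringHomTC Fq R.leadingCoeff ≠ 0 :=
    fun R hR => (map_ne_zero_iff _ (ringHomTC_injective hq)).2 (leadingCoeff_ne_zero.2 hR)
  have hSP := logb_eval_eq q v (hlead P hP0) hr0
  have hSQ := logb_eval_eq q v (hlead Q hQ0) hs0
  rw [← absL_evalP_eq_prod hext hr ξ] at hSP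
  rw [← absL_evalP_eq_prod hext hs ξ] at hSQ
  have hgP := abs_logHeightAt_sub_le hq hna hPn (hlead P hP0) hr0
  have hgQ := abs_logHeightAt_sub_le hq hna hQn (hlead Q hQ0) hs0
  rw [← heightP_eq_prod hq hna hext hr, hext, abs_le] at hgP
  rw [← heightP_eq_prod hq hna hext hs, hext, abs_le] at hgQ
  have hmin := sum_min_le_of_resultant hq hna (ξ := iota Fq ξ) (hlead P hP0) (hlead Q hQ0)
    (one_le_resultant_prod hq hext hP0 hPQ hr hs)
  have hPlog := Real.logb_le_logb_of_le h1 (absL_pos hq (hξ P hP0 hPn)) hP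
  rw [Real.logb_rpow_eq_mul_logb_of_pos (one_pos.trans_le hHP)] at hPlog
  have hA : 0 ≤ w + 1 := by rw [hw]; linarith
  have hrA := fun i => max_zero_neg_logb_le h1 hHP hA (hPα _ (evalPC_root hr i))
  have hsA := fun i => max_zero_neg_logb_le h1 hHQ hA (hQα _ (evalPC_root hs i))
  rw [hw] at hrA hsA
  have hh' := Real.logb_nonneg h1 hHQ
  have hhh := Real.logb_le_logb_of_le h1 (one_pos.trans_le hHQ) hQP
  have hμ : 0 ≤ n * Real.logb q (max 1 (absL Fq q ξ)) :=
    mul_nonneg (by positivity) (Real.logb_nonneg h1 (le_max_left _ _))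
  set μ := n * Real.logb q (max 1 (absL Fq q ξ))
  set h := Real.logb q (heightP Fq q P)
  set h' := Real.logb q (heightP Fq q Q)
  have hnμ : μ ≤ n * μ := le_mul_of_one_le_left hμ hn'
  refine mul_le_of_sum_min_le (fun i => le_max_left _ _) (fun j => le_max_left _ _) hn' hh' hhh hη
    hη1 ?_ ?_ hrA hsA (hmin.trans ?_)
  · linarith
  · linarith
  · have hk : ∀ {k : ℕ} {g t : ℝ}, k ≤ n → g ≤ t → 0 ≤ t → k * g ≤ n * t := by
      intro k g t hk hg ht
      calc (k : ℝ) * g ≤ k * t := by gcongr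
        _ ≤ n * t := by gcongr
    have hkP := hk hQn (sub_le_iff_le_add'.1 hgP.2) (by linarith)
    have hkQ := hk hPn (sub_le_iff_le_add'.1 hgQ.2) (by linarith)
    linarith

lemma le_wnStar [Fintype Fq] {q : ℕ} (hq : 1 < q) {n : ℕ} (hn : 1 ≤ n) {ξ : LaurentSeries Fq}
    (hξ : ∀ P : Polynomial (Polynomial Fq), P ≠ 0 → P.natDegree ≤ n → evalP Fq ξ P ≠ 0)
    {w : ℝ} (hw0 : ((n : ℝ) + 1) / 2 - 1 ≤ w) (hw : w < ((n : ℝ) + 1) / 2) :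
    (w : EReal) ≤ wnStar Fq q n ξ := by
  have h1 : (1 : ℝ) < q := by exact_mod_cast hq
  have hq0 : (0 : ℝ) < q := by positivity
  have hn' : (1 : ℝ) ≤ n := by exact_mod_cast hn
  refine le_sSup ⟨w, fun hfin => ?_, rfl⟩
  obtain ⟨v, hna, hv, hext⟩ := exists_absC_eq (Fq := Fq) hq
  obtain ⟨B, hB⟩ := exists_rpow_le_of_finite hq hna hv hext hξ (by linarith) hfin
  obtain ⟨δ, hδ, hδB⟩ := exists_le_absL_evalP hq hξ B
  obtain ⟨c, hc, hmink⟩ := exists_evalP_small (Fq := Fq) hq n ξ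
  set η : ℝ := (n + 1) / 2 - w with hη
  set e : ℝ := max 0 (n + Real.logb q c) with he
  set M : ℝ := 8 * (2 * n * (n * Real.logb q (max 1 (absL Fq q ξ))) + e) with hM
  obtain ⟨P, hPirr, hPn, hPB, hP⟩ := exists_irreducible_evalP_small hq hξ
    (w := n - η / 4) (by linarith) (by linarith) (max (max 1 B) (max (q * (c / δ)) (q ^ (M / η))))
  simp only [max_lt_iff] at hPB
  obtain ⟨⟨hP1, hPB⟩, hPδ, hPM⟩ := hPB
  have hP0 := hPirr.ne_zero
  have hdeg : P.natDegree ≠ 0 := fun h =>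
    (one_le_absL_evalP_of_natDegree_eq_zero hq ξ hP0 h).not_gt
      (hP.trans_lt (Real.rpow_lt_one_of_one_lt_of_neg hP1 (by linarith)))
  obtain ⟨N, hN⟩ : ∃ N : ℕ, heightP Fq q P = (q : ℝ) ^ (N + 1) := by
    rw [heightP, if_neg hP0] at hP1 ⊢
    obtain ⟨N, hN⟩ := Nat.exists_eq_succ_of_ne_zero (n := P.support.sup fun i =>
      (P.coeff i).natDegree) fun h => by simp [h] at hP1
    exact ⟨N, by rw [hN]⟩
  obtain ⟨Q, hQ0, hQn, hQN, hQ⟩ := hmink N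
  have hQP : heightP Fq q Q < heightP Fq q P :=
    hQN.trans_lt (by rw [hN]; exact pow_lt_pow_right₀ h1 (Nat.lt_succ_self N))
  have hPQ : ¬ P ∣ Q := fun h => (heightP_le_of_dvd hq hna hext hQ0 h).not_gt hQP
  have hQpos := absL_pos hq (hξ Q hQ0 hQn)
  have hQB : B < heightP Fq q Q := by
    by_contra! hle
    have hδQ := hδB Q hQ0 hQn hle
    rw [hN, pow_succ', mul_lt_mul_iff_right₀ hq0, div_lt_iff₀ hδ] at hPδ
    have : (q : ℝ) ^ N * δ ≤ c :=
      calc (q : ℝ) ^ N * δ = δ * (q : ℝ) ^ N := mul_comm _ _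
        _ ≤ absL Fq q (evalP Fq ξ Q) * (q : ℝ) ^ (n * N) :=
          mul_le_mul hδQ (pow_le_pow_right₀ h1.le (Nat.le_mul_of_pos_left N hn)) (by positivity)
            hQpos.le
        _ ≤ c := hQ
    linarith
  have hQlog : Real.logb q (absL Fq q (evalP Fq ξ Q)) ≤
      -(n * Real.logb q (heightP Fq q P)) + e := by
    have := Real.logb_le_logb_of_le h1 (by positivity) hQ
    rw [Real.logb_mul hQpos.ne' (by positivity), Real.logb_pow, Real.logb_self_eq_one h1] at this
    rw [hN, Real.logb_pow, Real.logb_self_eq_one h1]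
    push_cast at this ⊢
    linarith [le_max_right 0 (n + Real.logb q c)]
  have hbound := logb_heightP_bounded hq hna hext hn hξ (w := w) (by linarith : 0 < η)
    (by linarith) (by linarith) (le_max_left _ _) hP0 hQ0 hPn hQn
    (resultant_ne_zero_of_not_dvd hPirr hdeg hPQ) hQP.le hP hQlog (hB P hP0 hPn hPB)
    (hB Q hQ0 hQn hQB)
  have hlog := (Real.lt_logb_iff_rpow_lt h1 (one_pos.trans hP1)).2 hPM
  rw [div_lt_iff₀ (by linarith)] at hlog
  linarith

end

end OotoT

/-- If `ξ` is not algebraic of degree at most `n` over `F_q(T)`, then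
`w_n(ξ) ≥ n` and `w_n^*(ξ) ≥ (n+1)/2`. -/
theorem wn_lower_bounds (p : ℕ) (hp : p.Prime) (q : ℕ) (hq : ∃ e : ℕ, 0 < e ∧ q = p ^ e)
    (Fq : Type) [Field Fq] [Fintype Fq] [CharP Fq p] (hcard : Fintype.card Fq = q)
    (n : ℕ) (hn : 1 ≤ n) (ξ : LaurentSeries Fq)
    (hξ : ∀ P : Polynomial (Polynomial Fq), P ≠ 0 → P.natDegree ≤ n → evalP Fq ξ P ≠ 0) :
    (n : EReal) ≤ wn Fq q n ξ ∧ (((n + 1 : ℝ) / 2 : ℝ) : EReal) ≤ wnStar Fq q n ξ := by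
  have hq1 : 1 < q := hcard ▸ Fintype.one_lt_card
  have hn0 : (0 : ℝ) < n := by exact_mod_cast hn
  refine ⟨?_, EReal.coe_le_of_forall_lt (sub_one_lt _) fun w hw0 hw => le_wnStar hq1 hn hξ hw0 hw⟩
  rw [← EReal.coe_natCast]
  exact EReal.coe_le_of_forall_lt hn0 fun w hw0 hw => le_wn hq1 hξ hw0 hw
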